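/- arXiv:2402.08213 — 3 statements merged into one kernel-verified Lean document; each statement's English description precedes it below -/
import Mathlib

section
/- Let a ≥ 0 and for each k ∈ ℕ set β_k := √((k+1/2)² + a); write i^s := exp(iπs/2) for real s. Then there exists a constant C > 0 such that for every k ≥ 1, | i^{−β_k} sin(πβ_k) − i^{−(k+1/2)} sin(π(k+1/2)) − i^{k+5/2} · aπ/(2(2k+1)) − i^{k+3/2} · 5π²a²/(8(2k+1)²) | ≤ C k^{−3}. (This is the asymptotic identity for the difference of oscillatory factors used to bound the term 𝓘₂₂ in the proof of Lemma 2.1.) -/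
/-- `β_k = √((k+1/2)² + a)`. -/
noncomputable def betaCoef (a : ℝ) (k : ℕ) : ℝ :=
  Real.sqrt (((k : ℝ) + 1 / 2) ^ 2 + a)

/-- For real `s`, `i^s := exp(iπs/2)`. -/
noncomputable def iPow (s : ℝ) : ℂ :=
  Complex.exp (Complex.I * Real.pi * (s : ℂ) / 2)

theorem iPow_add (s t : ℝ) : iPow (s + t) = iPow s * iPow t := by
  unfold iPow
  rw [← Complex.exp_add]
  congr 1
  push_cast
  ring

theorem norm_iPow (s : ℝ) : ‖iPow s‖ = 1 := by
  unfold iPow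
  rw [show Complex.I * Real.pi * (s : ℂ) / 2 = ((Real.pi * s / 2 : ℝ) : ℂ) * Complex.I by
    push_cast; ring]
  exact Complex.norm_exp_ofReal_mul_I _

theorem iPow_two : iPow 2 = -1 := by
  unfold iPow
  rw [← Complex.exp_pi_mul_I]
  congr 1
  push_cast
  ring

theorem iPow_one : iPow 1 = Complex.I := by
  unfold iPow
  rw [Complex.ofReal_one, show Complex.I * Real.pi * 1 / 2 = Real.pi / 2 * Complex.I by ring]
  exact Complex.exp_pi_div_two_mul_I

theorem iPow_two_mul_natCast (k : ℕ) : iPow (2 * k) = (-1) ^ k := by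
  rw [← iPow_two]
  unfold iPow
  rw [← Complex.exp_nat_mul]
  congr 1
  push_cast
  ring

theorem iPow_neg_mul_sin (k : ℕ) (d : ℝ) :
    iPow (-((k : ℝ) + 1 / 2 + d)) * (Real.sin (Real.pi * ((k : ℝ) + 1 / 2 + d)) : ℂ) =
      iPow ((k : ℝ) - 1 / 2) * (iPow (-d) * (Real.cos (Real.pi * d) : ℂ)) := by
  have hsin : Real.sin (Real.pi * ((k : ℝ) + 1 / 2 + d)) = (-1) ^ k * Real.cos (Real.pi * d) := by
    rw [← Real.sin_add_pi_div_two, ← Real.sin_add_nat_mul_pi]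
    congr 1
    ring
  have hpow : iPow (-((k : ℝ) + 1 / 2)) * (-1) ^ k = iPow ((k : ℝ) - 1 / 2) := by
    rw [← iPow_two_mul_natCast, ← iPow_add]
    congr 1
    ring
  rw [hsin, neg_add, iPow_add, ← hpow]
  push_cast
  ring

theorem norm_exp_sub_quadratic_le (z : ℂ) :
    ‖Complex.exp z - (1 + z + z ^ 2 / 2)‖ ≤ ‖z‖ ^ 3 * Real.exp ‖z‖ := by
  simpa [Finset.sum_range_succ] using Complex.norm_exp_sub_sum_le_norm_mul_exp z 3

theorem norm_iPow_neg_mul_cos_sub_le (d x : ℝ) (hx : x = Real.pi * d) :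
    ‖iPow (-d) * (Real.cos x : ℂ) - (1 - Complex.I * x / 2 - 5 * (x : ℂ) ^ 2 / 8)‖ ≤
      2 * |x| ^ 3 * Real.exp (2 * |x|) := by
  set u : ℂ := Complex.I * x / 2 with hu
  set v : ℂ := -3 * Complex.I * x / 2 with hv
  have hnu : ‖u‖ = |x| / 2 := by simp [hu]
  have hnv : ‖v‖ = 3 * |x| / 2 := by simp [hv]
  have hprod : iPow (-d) * (Real.cos x : ℂ) = (Complex.exp u + Complex.exp v) / 2 := by
    have h1 : iPow (-d) = Complex.exp (-(Complex.I * x / 2)) := by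
      unfold iPow
      rw [hx]
      congr 1
      push_cast
      ring
    rw [h1, Complex.ofReal_cos, Complex.cos, mul_div_assoc', mul_add, ← Complex.exp_add,
      ← Complex.exp_add]
    congr 3
    · rw [hu]
      ring
    · rw [hv]
      ring
  have hsplit : iPow (-d) * (Real.cos x : ℂ) - (1 - Complex.I * x / 2 - 5 * (x : ℂ) ^ 2 / 8) =
      ((Complex.exp u - (1 + u + u ^ 2 / 2)) + (Complex.exp v - (1 + v + v ^ 2 / 2))) / 2 := by
    rw [hprod, hu, hv]
    ring_nf
    rw [Complex.I_sq]
    ring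
  have hbu := norm_exp_sub_quadratic_le u
  have hbv := norm_exp_sub_quadratic_le v
  rw [hnu] at hbu
  rw [hnv] at hbv
  have hx0 := abs_nonneg x
  have heu : Real.exp (|x| / 2) ≤ Real.exp (2 * |x|) := Real.exp_le_exp.2 (by linarith)
  have hev : Real.exp (3 * |x| / 2) ≤ Real.exp (2 * |x|) := Real.exp_le_exp.2 (by linarith)
  have hmu := mul_le_mul_of_nonneg_left heu (show 0 ≤ (|x| / 2) ^ 3 by positivity)
  have hmv := mul_le_mul_of_nonneg_left hev (show 0 ≤ (3 * |x| / 2) ^ 3 by positivity)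
  have htri := norm_add_le (Complex.exp u - (1 + u + u ^ 2 / 2))
    (Complex.exp v - (1 + v + v ^ 2 / 2))
  have hpos : 0 ≤ |x| ^ 3 * Real.exp (2 * |x|) := by positivity
  rw [hsplit, norm_div, Complex.norm_ofNat]
  linarith

theorem betaCoef_sub_bounds {a : ℝ} (ha : 0 ≤ a) {k : ℕ} (hk : 1 ≤ k) :
    0 ≤ betaCoef a k - (k + 1 / 2) ∧ betaCoef a k - (k + 1 / 2) ≤ a / (2 * k + 1) ∧
      a / (2 * k + 1) - (betaCoef a k - (k + 1 / 2)) ≤ a ^ 2 / (k : ℝ) ^ 3 := by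
  have hk0 : (0 : ℝ) < k := by exact_mod_cast hk
  set δ := betaCoef a k - (k + 1 / 2) with hδ
  have hsq : betaCoef a k ^ 2 = ((k : ℝ) + 1 / 2) ^ 2 + a := Real.sq_sqrt (by positivity)
  have h0 : 0 ≤ δ := sub_nonneg.2 (Real.le_sqrt_of_sq_le (by linarith))
  have heq : δ * (2 * k + 1) + δ ^ 2 = a := by
    rw [hδ]
    linear_combination hsq
  have hle : δ ≤ a / (2 * k + 1) := by
    rw [le_div_iff₀ (by positivity)]
    nlinarith [sq_nonneg δ]
  refine ⟨h0, hle, ?_⟩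
  have hdiff : a / (2 * k + 1) - δ = δ ^ 2 / (2 * k + 1) := by
    field_simp
    linarith
  calc a / (2 * k + 1) - δ = δ ^ 2 / (2 * k + 1) := hdiff
    _ ≤ (a / (2 * k + 1)) ^ 2 / (2 * k + 1) := by gcongr
    _ = a ^ 2 / (2 * k + 1) ^ 3 := by field_simp
    _ ≤ a ^ 2 / (k : ℝ) ^ 3 := by gcongr; linarith

theorem stmt11 (a : ℝ) (ha : 0 ≤ a) :
    ∃ C > 0, ∀ k : ℕ, 1 ≤ k →
      ‖iPow (-betaCoef a k) * (Real.sin (Real.pi * betaCoef a k) : ℂ)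
          - iPow (-((k : ℝ) + 1 / 2)) * (Real.sin (Real.pi * ((k : ℝ) + 1 / 2)) : ℂ)
          - iPow ((k : ℝ) + 5 / 2) * ((a : ℂ) * Real.pi / (2 * (2 * (k : ℂ) + 1)))
          - iPow ((k : ℝ) + 3 / 2) *
              (5 * (Real.pi : ℂ) ^ 2 * (a : ℂ) ^ 2 / (8 * (2 * (k : ℂ) + 1) ^ 2))‖
        ≤ C / (k : ℝ) ^ 3 := by
  have hπ := Real.pi_pos
  set A := Real.pi * a with hA
  have hA0 : 0 ≤ A := by positivity
  refine ⟨2 * A ^ 3 * Real.exp (2 * A) + Real.pi * a ^ 2 * (1 / 2 + 5 / 4 * A) + 1,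
    by positivity, fun k hk => ?_⟩
  have hk1 : (1 : ℝ) ≤ k := by exact_mod_cast hk
  have hk0 : (0 : ℝ) < k := by linarith
  obtain ⟨hδ0, hδ1, hδ2⟩ := betaCoef_sub_bounds ha hk
  set δ := betaCoef a k - (k + 1 / 2) with hδ
  set w := iPow ((k : ℝ) - 1 / 2) with hw
  set x := Real.pi * δ with hx
  set y := Real.pi * (a / (2 * k + 1)) with hy
  have hx0 : 0 ≤ x := by positivity
  have hxy : x ≤ y := by rw [hx, hy]; gcongr
  have hyk : y ≤ A / k := by
    rw [hy, hA, mul_div_assoc]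
    gcongr
    linarith
  have hyA : y ≤ A := hyk.trans (div_le_self hA0 hk1)
  have hyx : y - x ≤ Real.pi * a ^ 2 / (k : ℝ) ^ 3 := by
    rw [hy, hx, ← mul_sub, mul_div_assoc]
    gcongr
  have hβ : iPow (-betaCoef a k) * (Real.sin (Real.pi * betaCoef a k) : ℂ) =
      w * (iPow (-δ) * (Real.cos x : ℂ)) := by
    rw [hw, hx, ← iPow_neg_mul_sin, hδ]
    simp only [add_sub_cancel]
  have hhalf : iPow (-((k : ℝ) + 1 / 2)) * (Real.sin (Real.pi * ((k : ℝ) + 1 / 2)) : ℂ) = w := by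
    have h := iPow_neg_mul_sin k 0
    have h0 : iPow 0 = 1 := by simp [iPow]
    simpa [h0, hw] using h
  have hfive : iPow ((k : ℝ) + 5 / 2) = w * -Complex.I := by
    rw [show (k : ℝ) + 5 / 2 = ((k : ℝ) - 1 / 2) + (2 + 1) by ring, iPow_add, iPow_add 2,
      iPow_two, iPow_one, neg_one_mul]
  have hthree : iPow ((k : ℝ) + 3 / 2) = w * -1 := by
    rw [show (k : ℝ) + 3 / 2 = ((k : ℝ) - 1 / 2) + 2 by ring, iPow_add, iPow_two]
  have hlin : (a : ℂ) * Real.pi / (2 * (2 * (k : ℂ) + 1)) = y / 2 := by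
    rw [hy]
    push_cast
    rw [mul_comm (2 : ℂ) (2 * (k : ℂ) + 1), ← div_div]
    ring
  have hquad : 5 * (Real.pi : ℂ) ^ 2 * (a : ℂ) ^ 2 / (8 * (2 * (k : ℂ) + 1) ^ 2) =
      5 * (y : ℂ) ^ 2 / 8 := by
    rw [hy]
    push_cast
    rw [mul_comm (8 : ℂ), ← div_div, mul_pow, div_pow]
    ring
  rw [hβ, hhalf, hfive, hthree, hlin, hquad]
  have hsplit : w * (iPow (-δ) * (Real.cos x : ℂ)) - w - w * -Complex.I * (y / 2)
      - w * -1 * (5 * (y : ℂ) ^ 2 / 8) =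
      w * ((iPow (-δ) * (Real.cos x : ℂ) - (1 - Complex.I * x / 2 - 5 * (x : ℂ) ^ 2 / 8))
        + (((y - x : ℝ) : ℂ) * Complex.I / 2 + ((5 / 8 * ((y - x) * (y + x)) : ℝ) : ℂ))) := by
    push_cast
    ring
  have hmain := norm_iPow_neg_mul_cos_sub_le δ x hx
  rw [abs_of_nonneg hx0] at hmain
  have hrest : ‖((y - x : ℝ) : ℂ) * Complex.I / 2‖ = (y - x) / 2 := by
    rw [norm_div, norm_mul, Complex.norm_real, Complex.norm_I, Complex.norm_ofNat, mul_one,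
      Real.norm_of_nonneg (sub_nonneg.2 hxy)]
  have hrest' : ‖((5 / 8 * ((y - x) * (y + x)) : ℝ) : ℂ)‖ = 5 / 8 * ((y - x) * (y + x)) := by
    rw [Complex.norm_real, Real.norm_of_nonneg]
    have := sub_nonneg.2 hxy
    have := hx0.trans hxy
    positivity
  have hcube : 2 * x ^ 3 * Real.exp (2 * x) ≤ 2 * (A / k) ^ 3 * Real.exp (2 * A) := by
    gcongr
    · exact hxy.trans hyk
    · exact hxy.trans hyA
  have hsum : (y - x) / 2 + 5 / 8 * ((y - x) * (y + x)) ≤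
      Real.pi * a ^ 2 / (k : ℝ) ^ 3 * (1 / 2 + 5 / 4 * A) := by
    calc (y - x) / 2 + 5 / 8 * ((y - x) * (y + x))
        = (y - x) * (1 / 2 + 5 / 8 * (y + x)) := by ring
      _ ≤ Real.pi * a ^ 2 / (k : ℝ) ^ 3 * (1 / 2 + 5 / 4 * A) := by
        have := hx0.trans hxy
        apply mul_le_mul hyx (by linarith) (by positivity) (by positivity)
  rw [hsplit, norm_mul, norm_iPow, one_mul]
  calc _ ≤ 2 * x ^ 3 * Real.exp (2 * x) + ((y - x) / 2 + 5 / 8 * ((y - x) * (y + x))) := by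
        refine (norm_add_le _ _).trans (add_le_add hmain ((norm_add_le _ _).trans ?_))
        rw [hrest, hrest']
    _ ≤ 2 * (A / k) ^ 3 * Real.exp (2 * A)
        + Real.pi * a ^ 2 / (k : ℝ) ^ 3 * (1 / 2 + 5 / 4 * A) + 1 / (k : ℝ) ^ 3 := by
        have : 0 ≤ 1 / (k : ℝ) ^ 3 := by positivity
        linarith
    _ = _ := by
        rw [div_pow]
        ring
end

section
/- There exists a constant C > 0 such that for every ρ ≥ 1, ∫_0^∞ e^{−ρ sinh s − s/2} ( 1 + s^{−1/2} + |log s| ) ds ≤ C ρ^{−1/2}. (This integral bound concludes the estimate of the term 𝓘₂₂ in the proof of Lemma 2.1.) -/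
open MeasureTheory

/-- The constant and logarithmic weights are controlled by `s ^ (±1 / 2)`. -/
theorem one_add_rpow_add_abs_log_le {s : ℝ} (hs : 0 < s) :
    1 + s ^ (-(1 : ℝ) / 2) + |Real.log s| ≤
      4 * s ^ ((1 / 2 : ℝ) - 1) + 3 * s ^ ((3 / 2 : ℝ) - 1) := by
  have e1 : ((1 / 2 : ℝ) - 1) = -(1 / 2) := by norm_num
  have e2 : ((3 / 2 : ℝ) - 1) = 1 / 2 := by norm_num
  rw [e1, e2, neg_div]
  have hp : 0 < s ^ (1 / 2 : ℝ) := Real.rpow_pos_of_pos hs _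
  have hn : 0 < s ^ (-(1 / 2) : ℝ) := Real.rpow_pos_of_pos hs _
  have hmul : s ^ (1 / 2 : ℝ) * s ^ (-(1 / 2) : ℝ) = 1 := by
    rw [← Real.rpow_add hs]; simp
  have hone : 1 ≤ s ^ (1 / 2 : ℝ) + s ^ (-(1 / 2) : ℝ) := by
    nlinarith [sq_nonneg (s ^ (1 / 2 : ℝ) - s ^ (-(1 / 2) : ℝ))]
  have hlog : Real.log s ≤ s ^ (1 / 2 : ℝ) / (1 / 2) :=
    Real.log_le_rpow_div hs.le (by norm_num)
  have hlog' : -Real.log s ≤ s ^ (-(1 / 2) : ℝ) / (1 / 2) := by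
    have h := Real.log_le_rpow_div (inv_pos.2 hs).le (ε := 1 / 2) (by norm_num)
    rwa [Real.log_inv, Real.inv_rpow hs.le, ← Real.rpow_neg hs.le] at h
  have habs : |Real.log s| ≤ 2 * s ^ (1 / 2 : ℝ) + 2 * s ^ (-(1 / 2) : ℝ) :=
    abs_le.2 ⟨by linarith, by linarith⟩
  linarith

theorem exp_neg_mul_sinh_sub_le {ρ s : ℝ} (hρ : 0 ≤ ρ) (hs : 0 ≤ s) :
    Real.exp (-ρ * Real.sinh s - s / 2) ≤ Real.exp (-(ρ * s)) := by
  have h := mul_le_mul_of_nonneg_left (Real.self_le_sinh_iff.2 hs) hρ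
  exact Real.exp_le_exp.2 (by linarith)

theorem integrableOn_rpow_sub_one_mul_exp_neg_mul {a r : ℝ} (ha : 0 < a) (hr : 0 < r) :
    IntegrableOn (fun s : ℝ => s ^ (a - 1) * Real.exp (-(r * s))) (Set.Ioi 0) := by
  simpa [neg_mul] using
    integrableOn_rpow_mul_exp_neg_mul_rpow (s := a - 1) (p := 1) (by linarith) one_pos hr

theorem stmt13 :
    ∃ C > 0, ∀ ρ : ℝ, 1 ≤ ρ →
      IntegrableOn
        (fun s : ℝ => Real.exp (-ρ * Real.sinh s - s / 2) *
          (1 + s ^ (-(1 : ℝ) / 2) + |Real.log s|)) (Set.Ioi 0) volume ∧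
      (∫ s in Set.Ioi (0 : ℝ), Real.exp (-ρ * Real.sinh s - s / 2) *
          (1 + s ^ (-(1 : ℝ) / 2) + |Real.log s|)) ≤ C * ρ ^ (-(1 : ℝ) / 2) := by
  have hΓ₁ : 0 < Real.Gamma (1 / 2) := Real.Gamma_pos_of_pos (by norm_num)
  have hΓ₃ : 0 < Real.Gamma (3 / 2) := Real.Gamma_pos_of_pos (by norm_num)
  refine ⟨4 * Real.Gamma (1 / 2) + 3 * Real.Gamma (3 / 2), by positivity, fun ρ hρ => ?_⟩
  have hρ₀ : 0 < ρ := by linarith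
  have h₁ := (integrableOn_rpow_sub_one_mul_exp_neg_mul (a := 1 / 2) (by norm_num) hρ₀).const_mul 4
  have h₃ := (integrableOn_rpow_sub_one_mul_exp_neg_mul (a := 3 / 2) (by norm_num) hρ₀).const_mul 3
  have hle : ∀ s ∈ Set.Ioi (0 : ℝ), Real.exp (-ρ * Real.sinh s - s / 2) *
      (1 + s ^ (-(1 : ℝ) / 2) + |Real.log s|) ≤
        4 * (s ^ ((1 / 2 : ℝ) - 1) * Real.exp (-(ρ * s))) +
          3 * (s ^ ((3 / 2 : ℝ) - 1) * Real.exp (-(ρ * s))) := by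
    intro s (hs : 0 < s)
    calc _ ≤ Real.exp (-(ρ * s)) *
          (4 * s ^ ((1 / 2 : ℝ) - 1) + 3 * s ^ ((3 / 2 : ℝ) - 1)) :=
          mul_le_mul (exp_neg_mul_sinh_sub_le hρ₀.le hs.le) (one_add_rpow_add_abs_log_le hs)
            (by positivity) (Real.exp_pos _).le
      _ = _ := by ring
  have hint : IntegrableOn (fun s : ℝ => Real.exp (-ρ * Real.sinh s - s / 2) *
      (1 + s ^ (-(1 : ℝ) / 2) + |Real.log s|)) (Set.Ioi 0) volume := by
    refine (h₁.add h₃).mono' (by fun_prop) ?_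
    filter_upwards [ae_restrict_mem measurableSet_Ioi] with s hs
    have hs₀ : 0 < s := hs
    rw [Real.norm_of_nonneg (by positivity)]
    exact hle s hs
  refine ⟨hint, (setIntegral_mono_on hint (h₁.add h₃) measurableSet_Ioi hle).trans ?_⟩
  simp only [Pi.add_apply]
  rw [integral_add h₁ h₃, integral_const_mul, integral_const_mul,
    Real.integral_rpow_mul_exp_neg_mul_Ioi (by norm_num) hρ₀,
    Real.integral_rpow_mul_exp_neg_mul_Ioi (by norm_num) hρ₀, one_div ρ,
    Real.inv_rpow hρ₀.le, Real.inv_rpow hρ₀.le, ← Real.rpow_neg hρ₀.le, ← Real.rpow_neg hρ₀.le,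
    neg_div]
  have hpow : ρ ^ (-(3 / 2) : ℝ) ≤ ρ ^ (-(1 / 2) : ℝ) :=
    Real.rpow_le_rpow_of_exponent_le hρ (by norm_num)
  nlinarith
end

section
/- Fix η ∈ (0, 1/2]. There exists a constant C > 0 such that for every ρ ≥ 0 the principal value integral P.V. ∫_{−η}^{η} e^{iρ cos θ} · (π+θ) e^{iθ/2} / ( i (e^{iθ} − 1) ) dθ, i.e. the limit as ε → 0+ of ∫_{ε ≤ |θ| ≤ η} e^{iρ cos θ} (π+θ) e^{iθ/2} / ( i (e^{iθ} − 1) ) dθ, exists and has modulus at most C, uniformly in ρ. (This is the uniform boundedness in ρ of the principal value integral over the arc Γ₁^η near the singular point z = i in the proof of Lemma 2.1.) -/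
open MeasureTheory

lemma cexp_I_mul_sub_one (θ : ℝ) :
    Complex.exp (Complex.I * (θ : ℂ)) - 1 =
      Complex.exp (Complex.I * (θ : ℂ) / 2) * (2 * Complex.I * (Real.sin (θ / 2) : ℂ)) := by
  have h1 : Complex.exp (Complex.I * (θ : ℂ)) =
      Complex.exp (Complex.I * (θ : ℂ) / 2) * Complex.exp (Complex.I * (θ : ℂ) / 2) := by
    rw [← Complex.exp_add]; congr 1; ring
  have h2 : Complex.exp (Complex.I * (θ : ℂ) / 2) * Complex.exp (-((θ / 2 : ℂ)) * Complex.I) = 1 := by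
    rw [← Complex.exp_add, ← Complex.exp_zero]; congr 1; ring
  have h3 : Complex.exp ((θ / 2 : ℂ) * Complex.I) = Complex.exp (Complex.I * (θ : ℂ) / 2) := by
    congr 1; ring
  push_cast
  rw [Complex.sin, h3, h1]
  linear_combination (Complex.exp (Complex.I * (θ : ℂ) / 2) * Complex.exp (Complex.I * (θ : ℂ) / 2) -
    Complex.exp (Complex.I * (θ : ℂ) / 2) * Complex.exp (-((θ / 2 : ℂ)) * Complex.I)) *
      Complex.I_sq + h2

lemma kernel_eq_add (E : ℂ) (θ : ℝ) :
    E * (((Real.pi : ℂ) + (θ : ℂ)) * Complex.exp (Complex.I * (θ : ℂ) / 2)) /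
      (Complex.I * (Complex.exp (Complex.I * (θ : ℂ)) - 1)) =
    E * ((-Real.pi / (2 * Real.sin (θ / 2)) : ℝ) : ℂ) +
      E * ((-θ / (2 * Real.sin (θ / 2)) : ℝ) : ℂ) := by
  rw [cexp_I_mul_sub_one]
  have he := Complex.exp_ne_zero (Complex.I * (θ : ℂ) / 2)
  generalize Complex.exp (Complex.I * (θ : ℂ) / 2) = e at he ⊢
  push_cast [-Complex.ofReal_sin]
  generalize ((Real.sin (θ / 2) : ℝ) : ℂ) = s
  rcases eq_or_ne s 0 with rfl | hs
  · simp
  · have hI := Complex.I_ne_zero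
    field_simp
    rw [Complex.I_sq]
    ring

lemma abs_div_pi_le_abs_sin_half {θ : ℝ} (h : |θ| ≤ Real.pi) :
    |θ| / Real.pi ≤ |Real.sin (θ / 2)| := by
  have h2 : |θ / 2| = |θ| / 2 := by rw [abs_div, abs_two]
  have := Real.mul_abs_le_abs_sin (x := θ / 2) (by rw [h2]; linarith)
  rw [h2] at this
  calc |θ| / Real.pi = 2 / Real.pi * (|θ| / 2) := by ring
    _ ≤ _ := this

lemma abs_div_two_sin_half_le {θ : ℝ} (h : |θ| ≤ Real.pi) :
    |-θ / (2 * Real.sin (θ / 2))| ≤ Real.pi / 2 := by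
  have h1 := abs_div_pi_le_abs_sin_half h
  rw [div_le_iff₀ Real.pi_pos] at h1
  rw [abs_div, abs_neg, abs_mul, abs_two]
  refine div_le_of_le_mul₀ (by positivity) (by positivity) ?_
  linarith

lemma abs_pi_div_two_sin_half_le {ε θ : ℝ} (hε : 0 < ε) (hθ : ε ≤ |θ|) (h : |θ| ≤ Real.pi) :
    |-Real.pi / (2 * Real.sin (θ / 2))| ≤ Real.pi ^ 2 / (2 * ε) := by
  have h1 := abs_div_pi_le_abs_sin_half h
  rw [div_le_iff₀ Real.pi_pos] at h1
  have hp := Real.pi_pos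
  have hs : 0 < |Real.sin (θ / 2)| := by
    by_contra hcon
    nlinarith [abs_nonneg (Real.sin (θ / 2))]
  rw [abs_div, abs_neg, abs_mul, abs_two, abs_of_pos hp, div_le_div_iff₀ (by positivity)
    (by positivity)]
  nlinarith

lemma setIntegral_eq_zero_of_odd {S : Set ℝ} (hS : MeasurableSet S) (hneg : ∀ x, -x ∈ S ↔ x ∈ S)
    {f : ℝ → ℂ} (hf : ∀ x, f (-x) = -f x) : ∫ x in S, f x = 0 := by
  rw [← integral_indicator hS]
  have h := integral_neg_eq_self (S.indicator f) volume
  have h2 : ∀ x, S.indicator f (-x) = -S.indicator f x := fun x => by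
    by_cases hx : x ∈ S
    · simp [Set.indicator, hneg, hx, hf]
    · simp [Set.indicator, hneg, hx]
  simp only [h2, integral_neg] at h
  exact self_eq_neg.mp h.symm

theorem stmt15 (η : ℝ) (hη0 : 0 < η) (hη : η ≤ 1 / 2) :
    ∃ C > 0, ∀ ρ : ℝ, 0 ≤ ρ → ∃ L : ℂ,
      Filter.Tendsto (fun ε : ℝ =>
          ∫ θ in {θ : ℝ | ε ≤ |θ| ∧ |θ| ≤ η},
            Complex.exp (Complex.I * (ρ : ℂ) * (Real.cos θ : ℂ)) *
              (((Real.pi : ℂ) + (θ : ℂ)) * Complex.exp (Complex.I * (θ : ℂ) / 2)) /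
              (Complex.I * (Complex.exp (Complex.I * (θ : ℂ)) - 1)))
        (nhdsWithin 0 (Set.Ioi 0)) (nhds L) ∧ ‖L‖ ≤ C := by
  have hηπ : η ≤ Real.pi := by linarith [Real.pi_gt_three]
  refine ⟨Real.pi / 2 * (2 * η), by positivity, fun ρ _ => ?_⟩
  set E : ℝ → ℂ := fun θ => Complex.exp (Complex.I * (ρ : ℂ) * (Real.cos θ : ℂ)) with hE
  have hEn : ∀ θ, ‖E θ‖ = 1 := fun θ => by
    have : Complex.I * (ρ : ℂ) * (Real.cos θ : ℂ) = ((ρ * Real.cos θ : ℝ) : ℂ) * Complex.I := by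
      push_cast; ring
    simp only [hE]
    rw [this, Complex.norm_exp_ofReal_mul_I]
  have hEm : Measurable E := by fun_prop
  set f : ℝ → ℂ := fun θ => E θ * ((-Real.pi / (2 * Real.sin (θ / 2)) : ℝ) : ℂ) with hf
  set g : ℝ → ℂ := fun θ => E θ * ((-θ / (2 * Real.sin (θ / 2)) : ℝ) : ℂ) with hg
  have hfm : Measurable f := by fun_prop
  have hgm : Measurable g := by fun_prop
  have hgb : ∀ θ, |θ| ≤ η → ‖g θ‖ ≤ Real.pi / 2 := fun θ hθ => by
    simp only [hg]
    rw [norm_mul, hEn, one_mul, Complex.norm_real]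
    exact abs_div_two_sin_half_le (hθ.trans hηπ)
  have hSm : ∀ ε : ℝ, MeasurableSet {θ : ℝ | ε ≤ |θ| ∧ |θ| ≤ η} := fun ε =>
    (measurableSet_le measurable_const measurable_norm).inter
      (measurableSet_le measurable_norm measurable_const)
  have hSsub : ∀ ε : ℝ, {θ : ℝ | ε ≤ |θ| ∧ |θ| ≤ η} ⊆ Set.Icc (-η) η :=
    fun ε θ hθ => abs_le.mp hθ.2
  have hSfin : ∀ ε : ℝ, volume {θ : ℝ | ε ≤ |θ| ∧ |θ| ≤ η} < ⊤ := fun ε =>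
    (measure_mono (hSsub ε)).trans_lt measure_Icc_lt_top
  refine ⟨∫ θ in Set.Icc (-η) η, g θ, ?_, ?_⟩
  · have key : ∀ ε ∈ Set.Ioi (0 : ℝ),
        ∫ θ, {θ : ℝ | ε ≤ |θ| ∧ |θ| ≤ η}.indicator g θ =
          ∫ θ in {θ : ℝ | ε ≤ |θ| ∧ |θ| ≤ η},
            Complex.exp (Complex.I * (ρ : ℂ) * (Real.cos θ : ℂ)) *
              (((Real.pi : ℂ) + (θ : ℂ)) * Complex.exp (Complex.I * (θ : ℂ) / 2)) /
              (Complex.I * (Complex.exp (Complex.I * (θ : ℂ)) - 1)) := by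
      intro ε hε
      have hfi : IntegrableOn f {θ : ℝ | ε ≤ |θ| ∧ |θ| ≤ η} := by
        refine IntegrableOn.of_bound (hSfin ε) hfm.aestronglyMeasurable
          (Real.pi ^ 2 / (2 * ε)) ((ae_restrict_iff' (hSm ε)).mpr (.of_forall fun θ hθ => ?_))
        simp only [hf]
        rw [norm_mul, hEn, one_mul, Complex.norm_real]
        exact abs_pi_div_two_sin_half_le hε hθ.1 (hθ.2.trans hηπ)
      have hgi : IntegrableOn g {θ : ℝ | ε ≤ |θ| ∧ |θ| ≤ η} :=
        IntegrableOn.of_bound (hSfin ε) hgm.aestronglyMeasurable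
          (Real.pi / 2) ((ae_restrict_iff' (hSm ε)).mpr (.of_forall fun θ hθ => hgb θ hθ.2))
      have hf0 : ∫ θ in {θ : ℝ | ε ≤ |θ| ∧ |θ| ≤ η}, f θ = 0 := by
        refine setIntegral_eq_zero_of_odd (hSm ε) (fun x => by simp) fun x => ?_
        simp only [hf, hE, Real.cos_neg, neg_div 2 x, Real.sin_neg, mul_neg, div_neg,
          Complex.ofReal_neg]
      simp only [kernel_eq_add]
      rw [integral_indicator (hSm ε)]
      have := integral_add hfi hgi
      rw [hf0, zero_add] at this
      exact this.symm
    refine Filter.Tendsto.congr' (Filter.eventually_of_mem self_mem_nhdsWithin key) ?_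
    rw [← integral_indicator measurableSet_Icc]
    refine tendsto_integral_filter_of_dominated_convergence
      ((Set.Icc (-η) η).indicator fun _ => Real.pi / 2)
      (.of_forall fun ε => (hgm.indicator (hSm ε)).aestronglyMeasurable)
      (.of_forall fun ε => .of_forall fun θ => ?_) ?_ (.of_forall fun θ => ?_)
    · by_cases hθ : θ ∈ {θ : ℝ | ε ≤ |θ| ∧ |θ| ≤ η}
      · rw [Set.indicator_of_mem hθ, Set.indicator_of_mem (hSsub ε hθ)]
        exact hgb θ hθ.2
      · rw [Set.indicator_of_notMem hθ, norm_zero]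
        exact Set.indicator_nonneg (fun _ _ => by positivity) θ
    · exact (integrable_indicator_iff measurableSet_Icc).mpr
        (integrableOn_const measure_Icc_lt_top.ne)
    · rcases eq_or_ne θ 0 with rfl | hθ
      · have hg0 : g 0 = 0 := by simp [hg]
        simp [Set.indicator, hg0]
      · refine tendsto_const_nhds.congr' ?_
        filter_upwards [Ioo_mem_nhdsGT (abs_pos.mpr hθ)] with ε hε
        simp only [Set.indicator, Set.mem_Icc, Set.mem_ofPred_eq, hε.2.le, true_and, abs_le]
  · have h := norm_setIntegral_le_of_norm_le_const (μ := volume) (s := Set.Icc (-η) η) (f := g)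
      measure_Icc_lt_top fun θ hθ => hgb θ (abs_le.mpr hθ)
    rwa [Real.volume_real_Icc_of_le (by linarith), sub_neg_eq_add, ← two_mul] at h
end
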